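/- arXiv:2405.06785 — 2 statements merged into one kernel-verified Lean document; each statement's English description precedes it below -/
import Mathlib

section
/- Let 𝒜 = (a_{i₁…i_m}) be an almost strictly semi-positive real tensor of order m ≥ 2 and dimension n ≥ 2. Then (a) every diagonal entry satisfies a_{ii…i} > 0 for all i ∈ {1,…,n}, and (b) there exists an index k ∈ {1,…,n} such that a_{kk…k} + Σ a_{k i₂…i_m} ≤ 0, where the sum runs over all index tuples (i₂,…,i_m) ≠ (k,…,k) with a_{k i₂…i_m} < 0. -/
/-- `(A x^{m-1})_i` for an order-`m = k+2`, dimension-`n` tensor `A`. -/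
def tmul {n k : ℕ} (A : (Fin (k + 2) → Fin n) → ℝ) (x : Fin n → ℝ) (i : Fin n) : ℝ :=
  ∑ f : Fin (k + 1) → Fin n, A (Fin.cons i f) * ∏ j, x (f j)

/-- `A` is strictly semi-positive. -/
def StrictSemiPos {n k : ℕ} (A : (Fin (k + 2) → Fin n) → ℝ) : Prop :=
  ∀ x : Fin n → ℝ, (∀ i, 0 ≤ x i) → x ≠ 0 → ∃ j, 0 < x j ∧ 0 < tmul A x j

/-- The principal subtensor of `A` indexed by `J` is strictly semi-positive. -/
def StrictSemiPosOn {n k : ℕ} (A : (Fin (k + 2) → Fin n) → ℝ) (J : Finset (Fin n)) : Prop :=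
  ∀ x : Fin n → ℝ, (∀ i, 0 ≤ x i) → (∀ i, i ∉ J → x i = 0) → x ≠ 0 →
    ∃ j, 0 < x j ∧ 0 < tmul A x j

/-- `A` is almost strictly semi-positive. -/
def AlmostStrictSemiPos {n k : ℕ} (A : (Fin (k + 2) → Fin n) → ℝ) : Prop :=
  (∀ J : Finset (Fin n), J.Nonempty → J ≠ Finset.univ → StrictSemiPosOn A J) ∧
    ∃ x : Fin n → ℝ, (∀ i, 0 < x i) ∧ ∀ i, tmul A x i ≤ 0

theorem cons_const {n k : ℕ} (i : Fin n) :
    (Fin.cons i (fun _ : Fin (k + 1) => i) : Fin (k + 2) → Fin n) = fun _ => i := by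
  funext j
  cases j using Fin.cases <;> simp

/-- The `i`-th entry of `A e_i^{m-1}` is the `i`-th diagonal entry of `A`. -/
theorem tmul_single_self {n k : ℕ} (A : (Fin (k + 2) → Fin n) → ℝ) (i : Fin n) :
    tmul A (Pi.single i 1) i = A (fun _ => i) := by
  unfold tmul
  rw [Finset.sum_eq_single (fun _ => i)]
  · simp [cons_const]
  · intro f _ hf
    obtain ⟨j, hj⟩ := Function.ne_iff.mp hf
    rw [Finset.prod_eq_zero (Finset.mem_univ j) (Pi.single_eq_of_ne hj 1), mul_zero]
  · simp

theorem StrictSemiPosOn.diag_pos {n k : ℕ} {A : (Fin (k + 2) → Fin n) → ℝ} {i : Fin n}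
    (h : StrictSemiPosOn A {i}) : 0 < A (fun _ => i) := by
  obtain ⟨j, hj, hpos⟩ := h (Pi.single i 1)
    (fun j => (Pi.single_nonneg.mpr zero_le_one : (0 : Fin n → ℝ) ≤ Pi.single i 1) j)
    (fun j hj => Pi.single_eq_of_ne (by simpa using hj) 1) (by simp)
  obtain rfl : j = i := by
    by_contra hne
    simp [Pi.single_eq_of_ne hne] at hj
  rwa [tmul_single_self] at hpos

/-- At a maximal coordinate `j` of `x ≥ 0`, the entry `(A x^{m-1})_j` is bounded below by
`x_j^{m-1}` times the sum of the diagonal entry and the negative off-diagonal entries. -/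
theorem diag_add_sum_neg_mul_pow_le_tmul {n k : ℕ} (A : (Fin (k + 2) → Fin n) → ℝ)
    {x : Fin n → ℝ} (hx : ∀ i, 0 ≤ x i) {j : Fin n} (hj : ∀ i, x i ≤ x j) :
    (A (fun _ => j) +
        ∑ f ∈ Finset.univ.filter
            (fun f : Fin (k + 1) → Fin n => f ≠ (fun _ => j) ∧ A (Fin.cons j f) < 0),
          A (Fin.cons j f)) * x j ^ (k + 1) ≤ tmul A x j := by
  have hdiag : A (fun _ => j) =
      ∑ f : Fin (k + 1) → Fin n, if f = (fun _ => j) then A (Fin.cons j f) else 0 := by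
    simp [cons_const]
  rw [hdiag, Finset.sum_filter, ← Finset.sum_add_distrib, Finset.sum_mul]
  refine Finset.sum_le_sum fun f _ => ?_
  by_cases hf : f = fun _ => j
  · simp [hf]
  · have hprod : ∏ i, x (f i) ≤ x j ^ (k + 1) := by
      simpa using Finset.prod_le_prod (s := Finset.univ) (fun i _ => hx (f i))
        (fun i _ => hj (f i))
    by_cases hneg : A (Fin.cons j f) < 0
    · simpa [hf, hneg] using mul_le_mul_of_nonpos_left hprod hneg.le
    · simpa [hf, hneg] using
        mul_nonneg (not_lt.mp hneg) (Finset.prod_nonneg fun i _ => hx (f i))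


/-- entrywise properties of almost strictly semi-positive tensors. -/
theorem stmt_9 {n k : ℕ} (hn : 2 ≤ n) (A : (Fin (k + 2) → Fin n) → ℝ)
    (hA : AlmostStrictSemiPos A) :
    (∀ i : Fin n, 0 < A (fun _ => i)) ∧
      ∃ j : Fin n,
        A (fun _ => j) +
          ∑ f ∈ Finset.univ.filter
              (fun f : Fin (k + 1) → Fin n => f ≠ (fun _ => j) ∧ A (Fin.cons j f) < 0),
            A (Fin.cons j f) ≤ 0 := by
  obtain ⟨hsub, x, hx, hAx⟩ := hA
  have : Nontrivial (Fin n) := Fin.nontrivial_iff_two_le.mpr hn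
  refine ⟨fun i => (hsub {i} (Finset.singleton_nonempty i) ?_).diag_pos, ?_⟩
  · obtain ⟨j, hj⟩ := exists_ne i
    exact fun h => hj (Finset.mem_singleton.mp (h ▸ Finset.mem_univ j))
  · obtain ⟨j, hj⟩ := Finite.exists_max x
    have hle := (diag_add_sum_neg_mul_pow_le_tmul A (fun i => (hx i).le) hj).trans (hAx j)
    exact ⟨j, nonpos_of_mul_nonpos_left hle (pow_pos (hx j) _)⟩
end

section
/- Let 𝒜 be a symmetric real tensor of order m ≥ 2 and dimension n ≥ 2. Then 𝒜 is almost strictly semi-positive if and only if 𝒜 is almost strictly copositive. -/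
/-- The homogeneous form `A x^m` of an order-`m = k+2` tensor. -/
def tpow {n k : ℕ} (A : (Fin (k + 2) → Fin n) → ℝ) (x : Fin n → ℝ) : ℝ :=
  ∑ g : Fin (k + 2) → Fin n, A g * ∏ j, x (g j)

/-- `A` is symmetric: invariant under every permutation of the indices. -/
def SymTensor {n k : ℕ} (A : (Fin (k + 2) → Fin n) → ℝ) : Prop :=
  ∀ (g : Fin (k + 2) → Fin n) (σ : Equiv.Perm (Fin (k + 2))), A (g ∘ σ) = A g

/-- `A` is copositive. -/
def Copos {n k : ℕ} (A : (Fin (k + 2) → Fin n) → ℝ) : Prop :=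
  ∀ x : Fin n → ℝ, (∀ i, 0 ≤ x i) → 0 ≤ tpow A x

/-- The principal subtensor of `A` indexed by `J` is copositive. -/
def CoposOn {n k : ℕ} (A : (Fin (k + 2) → Fin n) → ℝ) (J : Finset (Fin n)) : Prop :=
  ∀ x : Fin n → ℝ, (∀ i, 0 ≤ x i) → (∀ i, i ∉ J → x i = 0) → 0 ≤ tpow A x

/-- `A` is almost copositive. -/
def AlmostCopos {n k : ℕ} (A : (Fin (k + 2) → Fin n) → ℝ) : Prop :=
  ¬ Copos A ∧ ∀ J : Finset (Fin n), J.Nonempty → J ≠ Finset.univ → CoposOn A J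

/-- `A` is strictly copositive. -/
def StrictCopos {n k : ℕ} (A : (Fin (k + 2) → Fin n) → ℝ) : Prop :=
  ∀ x : Fin n → ℝ, (∀ i, 0 ≤ x i) → x ≠ 0 → 0 < tpow A x

/-- The principal subtensor of `A` indexed by `J` is strictly copositive. -/
def StrictCoposOn {n k : ℕ} (A : (Fin (k + 2) → Fin n) → ℝ) (J : Finset (Fin n)) : Prop :=
  ∀ x : Fin n → ℝ, (∀ i, 0 ≤ x i) → (∀ i, i ∉ J → x i = 0) → x ≠ 0 → 0 < tpow A x

/-- `A` is almost strictly copositive. -/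
def AlmostStrictCopos {n k : ℕ} (A : (Fin (k + 2) → Fin n) → ℝ) : Prop :=
  ¬ StrictCopos A ∧
    ∀ J : Finset (Fin n), J.Nonempty → J ≠ Finset.univ → StrictCoposOn A J

theorem tpow_eq_sum_mul_tmul {n k : ℕ} (A : (Fin (k + 2) → Fin n) → ℝ) (x : Fin n → ℝ) :
    tpow A x = ∑ i, x i * tmul A x i := by
  rw [tpow, ← (Fin.consEquiv fun _ => Fin n).sum_comp, Fintype.sum_prod_type]
  refine Finset.sum_congr rfl fun i _ => ?_
  rw [tmul, Finset.mul_sum]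
  refine Finset.sum_congr rfl fun f _ => ?_
  change A (Fin.cons i f) * ∏ j, x (Fin.cons (α := fun _ => Fin n) i f j) = _
  simp only [Fin.prod_univ_succ (n := k + 1), Fin.cons_zero, Fin.cons_succ]
  ring

theorem tpow_smul {n k : ℕ} (A : (Fin (k + 2) → Fin n) → ℝ) (c : ℝ) (x : Fin n → ℝ) :
    tpow A (c • x) = c ^ (k + 2) * tpow A x := by
  simp only [tpow, Finset.mul_sum, Pi.smul_apply, smul_eq_mul, Finset.prod_mul_distrib,
    Finset.prod_const, Finset.card_univ, Fintype.card_fin]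
  exact Finset.sum_congr rfl fun g _ => by ring

theorem continuous_tpow {n k : ℕ} (A : (Fin (k + 2) → Fin n) → ℝ) : Continuous (tpow A) := by
  unfold tpow
  fun_prop

theorem SymTensor.apply_insertNth {n k : ℕ} {A : (Fin (k + 2) → Fin n) → ℝ} (hA : SymTensor A)
    (l : Fin (k + 2)) (i : Fin n) (f : Fin (k + 1) → Fin n) :
    A (l.insertNth i f) = A (Fin.cons i f) := by
  rw [← Fin.cons_comp_cycleRange]
  exact hA _ _

/-- The partial derivative of `A x^m` in the direction `e_j` is `m (A x^{m-1})_j`. -/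
theorem SymTensor.hasDerivAt_tpow {n k : ℕ} {A : (Fin (k + 2) → Fin n) → ℝ} (hA : SymTensor A)
    (x : Fin n → ℝ) (j : Fin n) :
    HasDerivAt (fun t : ℝ => tpow A (x + t • Pi.single j 1)) ((k + 2) * tmul A x j) 0 := by
  have hcoord (i : Fin n) : HasDerivAt (fun t : ℝ => (x + t • (Pi.single j 1 : Fin n → ℝ)) i)
      ((Pi.single j 1 : Fin n → ℝ) i) 0 := by
    simpa using ((hasDerivAt_id (0 : ℝ)).mul_const ((Pi.single j 1 : Fin n → ℝ) i)).const_add (x i)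
  have hd := HasDerivAt.fun_sum (u := Finset.univ) fun (g : Fin (k + 2) → Fin n) _ =>
    (HasDerivAt.fun_finsetProd (u := Finset.univ) fun l _ => hcoord (g l)).const_mul (A g)
  refine hd.congr_deriv ?_
  simp only [zero_smul, add_zero, smul_eq_mul, Finset.mul_sum]
  rw [Finset.sum_comm]
  have hl (l : Fin (k + 2)) : ∑ g : Fin (k + 2) → Fin n, A g *
      ((∏ l' ∈ Finset.univ.erase l, x (g l')) * (Pi.single j 1 : Fin n → ℝ) (g l)) =
      tmul A x j := by
    rw [← (Fin.insertNthEquiv (fun _ => Fin n) l).sum_comp, Fintype.sum_prod_type,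
      Finset.sum_eq_single j]
    · refine Finset.sum_congr rfl fun f _ => ?_
      have he : Finset.univ.erase l = Finset.univ.image l.succAbove := by
        rw [Fin.image_succAbove_univ]; ext; simp
      rw [he, Finset.prod_image fun _ _ _ _ h => Fin.succAbove_right_injective h]
      have hf : A (Fin.insertNthEquiv (fun _ => Fin n) l (j, f)) = A (Fin.cons j f) :=
        hA.apply_insertNth l j f
      simp [hf]
    · intro i _ hij
      exact Finset.sum_eq_zero fun f _ => by simp [hij]
    · simp
  simp [hl]

/-- A minimizer of `A x^m` over a face of the standard simplex satisfies the KKT conditions. -/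
theorem SymTensor.exists_minimizer {n k : ℕ} {A : (Fin (k + 2) → Fin n) → ℝ} (hA : SymTensor A)
    {J : Finset (Fin n)} (hJ : J.Nonempty) :
    ∃ x : Fin n → ℝ, (∀ i, 0 ≤ x i) ∧ (∀ i, i ∉ J → x i = 0) ∧ x ≠ 0 ∧
      (∀ j, 0 < x j → tmul A x j = tpow A x) ∧
      ∀ y : Fin n → ℝ, (∀ i, 0 ≤ y i) → (∀ i, i ∉ J → y i = 0) →
        tpow A x * (∑ i, y i) ^ (k + 2) ≤ tpow A y := by
  have hK : IsCompact (stdSimplex ℝ (Fin n) ∩ {x | ∀ i, i ∉ J → x i = 0}) := by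
    refine (isCompact_stdSimplex ℝ (Fin n)).inter_right ?_
    simp only [Set.ofPred_forall]
    exact isClosed_iInter fun i => isClosed_iInter fun _ =>
      isClosed_eq (continuous_apply i) continuous_const
  obtain ⟨j₀, hj₀⟩ := hJ
  obtain ⟨x, ⟨⟨hx0, hx1⟩, hxJ⟩, hmin⟩ := hK.exists_isMinOn
    ⟨Pi.single j₀ 1, single_mem_stdSimplex ℝ j₀, fun i hi =>
      Pi.single_eq_of_ne (ne_of_mem_of_not_mem hj₀ hi).symm 1⟩ (continuous_tpow A).continuousOn
  have hle (y : Fin n → ℝ) (hy0 : ∀ i, 0 ≤ y i) (hyJ : ∀ i, i ∉ J → y i = 0) :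
      tpow A x * (∑ i, y i) ^ (k + 2) ≤ tpow A y := by
    obtain ⟨s, hs⟩ : ∃ s, ∑ i, y i = s := ⟨_, rfl⟩
    have hs0 : 0 ≤ s := hs ▸ Finset.sum_nonneg fun i _ => hy0 i
    rw [hs]
    rcases hs0.eq_or_lt with h | h
    · have hy : y = 0 := funext fun i =>
        (Finset.sum_eq_zero_iff_of_nonneg fun i _ => hy0 i).1 (hs.trans h.symm) i (Finset.mem_univ i)
      simp [← h, hy, tpow]
    · have hm : tpow A x ≤ tpow A (s⁻¹ • y) := hmin
        ⟨⟨fun i => mul_nonneg (inv_nonneg.2 h.le) (hy0 i), by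
          simp [← Finset.mul_sum, hs, h.ne']⟩, fun i hi => by simp [hyJ i hi]⟩
      calc tpow A x * s ^ (k + 2) ≤ tpow A (s⁻¹ • y) * s ^ (k + 2) := by gcongr
        _ = tpow A y := by rw [tpow_smul, mul_right_comm, ← mul_pow, inv_mul_cancel₀ h.ne', one_pow, one_mul]
  refine ⟨x, hx0, hxJ, fun h => by simp [h] at hx1, fun j hj => ?_, hle⟩
  have hjJ : j ∈ J := by
    by_contra h
    exact hj.ne' (hxJ j h)
  have hloc : IsLocalMin (fun t : ℝ => tpow A (x + t • Pi.single j 1) -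
      tpow A x * (1 + t) ^ (k + 2)) 0 := by
    filter_upwards [eventually_gt_nhds (neg_lt_zero.2 hj)] with t ht
    have := hle (x + t • Pi.single j 1) (fun i => by
      rcases eq_or_ne i j with rfl | h
      · simp; linarith
      · simp [h, hx0 i]) (fun i hi => by
      have : i ≠ j := fun h => hi (h ▸ hjJ)
      simp [this, hxJ i hi])
    simp [Finset.sum_add_distrib, hx1, ← Finset.mul_sum] at this
    simpa using this
  have hpow : HasDerivAt (fun t : ℝ => tpow A x * (1 + t) ^ (k + 2))
      (tpow A x * (k + 2)) 0 := by
    simpa using (((hasDerivAt_id (0 : ℝ)).const_add 1).fun_pow (k + 2)).const_mul (tpow A x)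
  have h0 := hloc.hasDerivAt_eq_zero ((hA.hasDerivAt_tpow x j).sub hpow)
  have hk : (k : ℝ) + 2 ≠ 0 := by positivity
  refine mul_left_cancel₀ hk ?_
  linarith

theorem StrictCoposOn.strictSemiPosOn {n k : ℕ} {A : (Fin (k + 2) → Fin n) → ℝ}
    {J : Finset (Fin n)} (h : StrictCoposOn A J) : StrictSemiPosOn A J := by
  intro x hx0 hxJ hx
  have hpos := h x hx0 hxJ hx
  rw [tpow_eq_sum_mul_tmul] at hpos
  obtain ⟨j, -, hj⟩ := Finset.exists_lt_of_sum_lt (f := fun _ => (0 : ℝ)) (by simpa using hpos)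
  have hxj : 0 < x j := (hx0 j).lt_of_ne fun h => by simp [← h] at hj
  exact ⟨j, hxj, pos_of_mul_pos_right hj hxj.le⟩

theorem StrictSemiPosOn.strictCoposOn {n k : ℕ} {A : (Fin (k + 2) → Fin n) → ℝ}
    (hA : SymTensor A) {J : Finset (Fin n)} (hJ : J.Nonempty) (h : StrictSemiPosOn A J) :
    StrictCoposOn A J := by
  intro y hy0 hyJ hy
  obtain ⟨x, hx0, hxJ, hx, hkkt, hle⟩ := hA.exists_minimizer hJ
  obtain ⟨j, hxj, hj⟩ := h x hx0 hxJ hx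
  rw [hkkt j hxj] at hj
  have hs : 0 < ∑ i, y i :=
    Fintype.sum_pos (lt_of_le_of_ne (fun i => hy0 i) hy.symm)
  exact (mul_pos hj (pow_pos hs _)).trans_le (hle y hy0 hyJ)

/-- a symmetric tensor is almost strictly semi-positive iff it is almost
strictly copositive. -/
theorem stmt_17 {n k : ℕ} (hn : 2 ≤ n) (A : (Fin (k + 2) → Fin n) → ℝ)
    (hsym : SymTensor A) :
    AlmostStrictSemiPos A ↔ AlmostStrictCopos A := by
  have : Nonempty (Fin n) := ⟨⟨0, by omega⟩⟩
  constructor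
  · rintro ⟨hproper, x, hx, hxA⟩
    refine ⟨fun hcop => ?_, fun J hJ hJu => (hproper J hJ hJu).strictCoposOn hsym hJ⟩
    have hpos := hcop x (fun i => (hx i).le) fun h =>
      (hx (Classical.arbitrary _)).ne' (congrFun h _)
    rw [tpow_eq_sum_mul_tmul] at hpos
    exact hpos.not_ge (Finset.sum_nonpos fun i _ =>
      mul_nonpos_of_nonneg_of_nonpos (hx i).le (hxA i))
  · rintro ⟨hncop, hproper⟩
    refine ⟨fun J hJ hJu => (hproper J hJ hJu).strictSemiPosOn, ?_⟩
    obtain ⟨x, hx0, -, hx, hkkt, hle⟩ := hsym.exists_minimizer Finset.univ_nonempty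
    have hval : tpow A x ≤ 0 := by
      by_contra! hpos
      exact hncop fun y hy0 hy =>
        (mul_pos hpos (pow_pos (Fintype.sum_pos (lt_of_le_of_ne (fun i => hy0 i) hy.symm)) _)).trans_le
          (hle y hy0 fun i hi => absurd (Finset.mem_univ i) hi)
    have hxpos (i : Fin n) : 0 < x i := by
      refine (hx0 i).lt_of_ne fun hi => ?_
      have hne : (Finset.univ.erase i).Nonempty := by
        rw [← Finset.card_pos, Finset.card_erase_of_mem (Finset.mem_univ i), Finset.card_fin]
        omega
      refine (hproper _ hne (fun h => Finset.notMem_erase i _ (h ▸ Finset.mem_univ i)) x hx0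
        (fun l hl => ?_) hx).not_ge hval
      have hli : l = i := by simpa using hl
      rw [hli, ← hi]
    exact ⟨x, hxpos, fun i => (hkkt i (hxpos i)).trans_le hval⟩
end
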